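/- Let a, b ∈ ℝ with a ≠ 0. Then for every x ∈ ℝ with x ≠ 0, ∫_{−∞}^{x} φ(y) Φ(a + b y) dy = ½Φ(x) + ½Φ(a/√(1+b²)) − ½·1{ a/(x√(1+b²)) < 0 } − T(x, (a + bx)/x) − T(a/√(1+b²), (ab + x(1+b²))/a), where T is Owen's T function. -/

import Mathlib

open Real MeasureTheory

/-- Standard normal density. -/
noncomputable def stdNormalPdf (x : ℝ) : ℝ := Real.exp (-x ^ 2 / 2) / Real.sqrt (2 * Real.pi)

/-- Standard normal cumulative distribution function. -/
noncomputable def stdNormalCdf (x : ℝ) : ℝ := ∫ t in Set.Iic x, stdNormalPdf t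

/-- Owen's T function. -/
noncomputable def owenT (h g : ℝ) : ℝ :=
  (1 / (2 * Real.pi)) * ∫ t in (0:ℝ)..g, Real.exp (-h ^ 2 * (1 + t ^ 2) / 2) / (1 + t ^ 2)

open Filter Topology Set

lemma stdNormalPdf_eq_gaussianPDFReal :
    stdNormalPdf = ProbabilityTheory.gaussianPDFReal 0 1 := by
  ext x
  simp [stdNormalPdf, ProbabilityTheory.gaussianPDFReal]
  ring

lemma continuous_stdNormalPdf : Continuous stdNormalPdf := by
  unfold stdNormalPdf
  fun_prop

lemma stdNormalPdf_nonneg (x : ℝ) : 0 ≤ stdNormalPdf x := by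
  unfold stdNormalPdf
  positivity

lemma stdNormalPdf_neg (x : ℝ) : stdNormalPdf (-x) = stdNormalPdf x := by
  simp [stdNormalPdf]

lemma integrable_stdNormalPdf : Integrable stdNormalPdf := by
  rw [stdNormalPdf_eq_gaussianPDFReal]
  exact ProbabilityTheory.integrable_gaussianPDFReal 0 1

lemma integral_stdNormalPdf : ∫ t, stdNormalPdf t = 1 := by
  rw [stdNormalPdf_eq_gaussianPDFReal]
  exact ProbabilityTheory.integral_gaussianPDFReal_eq_one 0 one_ne_zero

lemma hasDerivAt_integral_Iic {f : ℝ → ℝ} (hf : Continuous f) (hi : Integrable f) (x : ℝ) :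
    HasDerivAt (fun x => ∫ y in Iic x, f y) (f x) x := by
  have h : (fun x => ∫ y in Iic x, f y) = fun x => (∫ y in Iic 0, f y) + ∫ y in (0:ℝ)..x, f y := by
    ext x
    rw [← intervalIntegral.integral_Iic_sub_Iic hi.integrableOn hi.integrableOn]
    ring
  rw [h]
  exact (intervalIntegral.integral_hasDerivAt_right (hf.intervalIntegrable _ _)
    (hf.stronglyMeasurableAtFilter _ _) hf.continuousAt).const_add _

lemma hasDerivAt_stdNormalCdf (x : ℝ) : HasDerivAt stdNormalCdf (stdNormalPdf x) x :=
  hasDerivAt_integral_Iic continuous_stdNormalPdf integrable_stdNormalPdf x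

lemma continuous_stdNormalCdf : Continuous stdNormalCdf :=
  continuous_iff_continuousAt.2 fun x => (hasDerivAt_stdNormalCdf x).continuousAt

lemma stdNormalCdf_neg (x : ℝ) : stdNormalCdf (-x) = 1 - stdNormalCdf x := by
  have h : stdNormalCdf (-x) = ∫ t in Ioi x, stdNormalPdf t := by
    have := integral_comp_neg_Iic (-x) stdNormalPdf
    simp only [stdNormalPdf_neg, neg_neg] at this
    exact this
  have h2 := intervalIntegral.integral_Iic_add_Ioi (b := x) (μ := volume)
    integrable_stdNormalPdf.integrableOn integrable_stdNormalPdf.integrableOn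
  rw [integral_stdNormalPdf] at h2
  rw [h, ← h2, stdNormalCdf]
  ring

lemma stdNormalCdf_zero : stdNormalCdf 0 = 1 / 2 := by
  have := stdNormalCdf_neg 0
  rw [neg_zero] at this
  linarith

lemma stdNormalCdf_nonneg (x : ℝ) : 0 ≤ stdNormalCdf x :=
  setIntegral_nonneg measurableSet_Iic fun t _ => stdNormalPdf_nonneg t

lemma stdNormalCdf_le_one (x : ℝ) : stdNormalCdf x ≤ 1 := by
  have := stdNormalCdf_nonneg (-x)
  rw [stdNormalCdf_neg] at this
  linarith

lemma tendsto_stdNormalCdf_atBot : Tendsto stdNormalCdf atBot (𝓝 0) :=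
  tendsto_integral_Iic_zero tendsto_id

lemma tendsto_stdNormalCdf_atTop : Tendsto stdNormalCdf atTop (𝓝 1) := by
  have h := (tendsto_stdNormalCdf_atBot.comp tendsto_neg_atTop_atBot).const_sub 1
  simp only [sub_zero] at h
  refine h.congr fun x => ?_
  simp [stdNormalCdf_neg]

lemma stdNormalCdf_sub_half (x : ℝ) :
    stdNormalCdf x - 1 / 2 = ∫ t in (0:ℝ)..x, stdNormalPdf t := by
  rw [← stdNormalCdf_zero]
  exact intervalIntegral.integral_Iic_sub_Iic integrable_stdNormalPdf.integrableOn
    integrable_stdNormalPdf.integrableOn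

/-- The kernel of Owen's T function. -/
noncomputable def owenKernel (h t : ℝ) : ℝ := exp (-h ^ 2 * (1 + t ^ 2) / 2) / (1 + t ^ 2)

lemma owenT_eq (h g : ℝ) : owenT h g = 1 / (2 * π) * ∫ t in (0:ℝ)..g, owenKernel h t := rfl

lemma continuous_owenKernel : Continuous (Function.uncurry owenKernel) := by
  unfold Function.uncurry owenKernel
  refine Continuous.div (by fun_prop) (by fun_prop) fun p => ?_
  positivity

lemma continuous_owenKernel_right (h : ℝ) : Continuous (owenKernel h) :=
  continuous_owenKernel.comp (by fun_prop : Continuous fun t : ℝ => (h, t))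

lemma owenT_neg_left (h g : ℝ) : owenT (-h) g = owenT h g := by
  simp [owenT]

lemma owenT_neg_right (h g : ℝ) : owenT h (-g) = -owenT h g := by
  have := intervalIntegral.integral_comp_neg (a := 0) (b := g) (owenKernel h)
  have h2 : ∀ t, owenKernel h (-t) = owenKernel h t := by simp [owenKernel]
  simp only [h2, neg_zero] at this
  rw [owenT_eq, owenT_eq, this, intervalIntegral.integral_symm]
  ring

lemma hasDerivAt_owenT_right (h g : ℝ) :
    HasDerivAt (owenT h) (1 / (2 * π) * owenKernel h g) g :=
  (intervalIntegral.integral_hasDerivAt_right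
    ((continuous_owenKernel_right h).intervalIntegrable _ _)
    ((continuous_owenKernel_right h).stronglyMeasurableAtFilter _ _)
    (continuous_owenKernel_right h).continuousAt).const_mul _

lemma continuous_owenT_right (h : ℝ) : Continuous (owenT h) :=
  continuous_iff_continuousAt.2 fun g => (hasDerivAt_owenT_right h g).continuousAt

lemma integral_exp_eq_pdf_mul_cdf (h g : ℝ) :
    1 / (2 * π) * (∫ t in (0:ℝ)..g, -h * exp (-h ^ 2 * (1 + t ^ 2) / 2)) =
      -stdNormalPdf h * (stdNormalCdf (h * g) - 1 / 2) := by
  have key := intervalIntegral.mul_integral_comp_mul_left (a := 0) (b := g) (f := stdNormalPdf) h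
  rw [stdNormalCdf_sub_half]
  rw [mul_zero] at key
  rw [← key, ← intervalIntegral.integral_const_mul, ← intervalIntegral.integral_const_mul,
    ← intervalIntegral.integral_const_mul]
  refine intervalIntegral.integral_congr fun t _ => ?_
  have e : exp (-h ^ 2 * (1 + t ^ 2) / 2) = exp (-h ^ 2 / 2) * exp (-(h * t) ^ 2 / 2) := by
    rw [← exp_add]
    congr 1
    ring
  have hs : 1 / (2 * π) = (√(2 * π))⁻¹ * (√(2 * π))⁻¹ := by
    rw [← mul_inv, mul_self_sqrt (by positivity), one_div]
  simp only [stdNormalPdf, e, hs]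
  ring

lemma hasDerivAt_owenT_left (h g : ℝ) :
    HasDerivAt (fun h => owenT h g) (-stdNormalPdf h * (stdNormalCdf (h * g) - 1 / 2)) h := by
  rw [← integral_exp_eq_pdf_mul_cdf]
  refine HasDerivAt.const_mul _ ?_
  refine (intervalIntegral.hasDerivAt_integral_of_dominated_loc_of_deriv_le
    (F := owenKernel) (F' := fun h t => -h * exp (-h ^ 2 * (1 + t ^ 2) / 2))
    (bound := fun _ => |h| + 1) (Metric.ball_mem_nhds h one_pos)
    (Eventually.of_forall fun y => (continuous_owenKernel_right y).aestronglyMeasurable)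
    ((continuous_owenKernel_right h).intervalIntegrable _ _)
    (Continuous.aestronglyMeasurable (by fun_prop))
    (Eventually.of_forall fun t _ y hy => ?_) (by simp)
    (Eventually.of_forall fun t _ y _ => ?_)).2
  · have h1 : |y| ≤ |h| + 1 := by
      rw [Metric.mem_ball, dist_eq] at hy
      have := abs_sub_abs_le_abs_sub y h
      linarith
    have h2 : exp (-y ^ 2 * (1 + t ^ 2) / 2) ≤ 1 := by
      rw [exp_le_one_iff]
      have : 0 ≤ y ^ 2 * (1 + t ^ 2) := by positivity
      linarith
    rw [norm_mul, norm_neg, norm_eq_abs, norm_eq_abs, abs_of_pos (exp_pos _)]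
    exact (mul_le_of_le_one_right (abs_nonneg y) h2).trans h1
  · have hd : HasDerivAt (fun y : ℝ => -y ^ 2 * (1 + t ^ 2) / 2) (-(y * (1 + t ^ 2))) y := by
      refine ((((hasDerivAt_id y).pow 2).neg.mul_const (1 + t ^ 2)).div_const 2).congr_deriv ?_
      simp
      ring
    refine (hd.exp.div_const (1 + t ^ 2)).congr_deriv ?_
    have : (1 + t ^ 2) ≠ 0 := by positivity
    field_simp

lemma hasDerivAt_owenT_comp {g : ℝ → ℝ} {g' x : ℝ} (hg : HasDerivAt g g' x) :
    HasDerivAt (fun x => owenT x (g x))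
      (-stdNormalPdf x * (stdNormalCdf (x * g x) - 1 / 2)
        + 1 / (2 * π) * owenKernel x (g x) * g') x := by
  have cP : Continuous fun p : ℝ × ℝ =>
      -stdNormalPdf p.1 * (stdNormalCdf (p.1 * p.2) - 1 / 2) := by
    have := continuous_stdNormalPdf
    have := continuous_stdNormalCdf
    fun_prop
  have cQ : Continuous fun p : ℝ × ℝ => 1 / (2 * π) * owenKernel p.1 p.2 :=
    continuous_const.mul continuous_owenKernel
  have cL : Continuous fun c : ℝ => ContinuousLinearMap.toSpanSingleton ℝ c :=
    (ContinuousLinearMap.toSpanSingletonCLE (𝕜 := ℝ) (E := ℝ)).continuous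
  have key := hasStrictFDerivAt_uncurry_coprod (𝕜 := ℝ) (u := (x, g x)) (f := owenT)
    (f₁ := fun h k => ContinuousLinearMap.toSpanSingleton ℝ
      (-stdNormalPdf h * (stdNormalCdf (h * k) - 1 / 2)))
    (f₂ := fun h k => ContinuousLinearMap.toSpanSingleton ℝ (1 / (2 * π) * owenKernel h k))
    (Eventually.of_forall fun v => (hasDerivAt_owenT_left v.1 v.2).hasFDerivAt)
    (Eventually.of_forall fun v => (hasDerivAt_owenT_right v.1 v.2).hasFDerivAt)
    (cL.comp cP).continuousAt (cL.comp cQ).continuousAt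
  have := key.hasFDerivAt.comp_hasDerivAt x ((hasDerivAt_id x).prodMk hg)
  refine this.congr_deriv ?_
  simp [Function.HasUncurry.uncurry]
  ring

lemma abs_owenT_le (h g : ℝ) : |owenT h g| ≤ exp (-h ^ 2 / 2) / 4 := by
  wlog hg : 0 ≤ g generalizing g
  · have := this (-g) (by linarith)
    rwa [owenT_neg_right, abs_neg] at this
  have h1 : ∫ t in (0:ℝ)..g, owenKernel h t ≤
      ∫ t in (0:ℝ)..g, exp (-h ^ 2 / 2) * (1 + t ^ 2)⁻¹ := by
    refine intervalIntegral.integral_mono_on hg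
      ((continuous_owenKernel_right h).intervalIntegrable _ _)
      (Continuous.intervalIntegrable (continuous_const.mul
        (Continuous.inv₀ (by fun_prop) fun t => by positivity)) _ _) fun t _ => ?_
    rw [owenKernel, div_eq_mul_inv]
    gcongr
    nlinarith [mul_nonneg (sq_nonneg h) (sq_nonneg t)]
  have h0 : 0 ≤ ∫ t in (0:ℝ)..g, owenKernel h t :=
    intervalIntegral.integral_nonneg hg fun t _ => by unfold owenKernel; positivity
  rw [intervalIntegral.integral_const_mul, integral_inv_one_add_sq, arctan_zero, sub_zero] at h1
  have h2 : exp (-h ^ 2 / 2) * arctan g ≤ exp (-h ^ 2 / 2) * (π / 2) := by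
    gcongr
    exact (arctan_lt_pi_div_two g).le
  rw [owenT_eq, abs_of_nonneg (by positivity)]
  calc _ ≤ 1 / (2 * π) * (exp (-h ^ 2 / 2) * (π / 2)) := by
        gcongr
        exact h1.trans h2
    _ = _ := by
        field_simp
        norm_num

lemma tendsto_owenT_zero {α : Type*} {l : Filter α} {u v : α → ℝ}
    (hu : Tendsto (fun i => u i ^ 2) l atTop) : Tendsto (fun i => owenT (u i) (v i)) l (𝓝 0) := by
  have h1 : Tendsto (fun i => exp (-(u i) ^ 2 / 2) / 4) l (𝓝 0) := by
    have h2 : Tendsto (fun i => -(u i) ^ 2 / 2) l atBot :=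
      (tendsto_neg_atTop_atBot.comp hu).atBot_div_const two_pos
    simpa using (tendsto_exp_atBot.comp h2).div_const 4
  exact squeeze_zero_norm (fun i => abs_owenT_le (u i) (v i)) h1

lemma abs_owenT_sub_arctan_le (h g : ℝ) :
    |owenT h g - 1 / (2 * π) * arctan g| ≤ 1 / (2 * π) * (h ^ 2 / 2 * |g|) := by
  have hi : Continuous fun t : ℝ => (1 + t ^ 2)⁻¹ :=
    Continuous.inv₀ (by fun_prop) fun t => by positivity
  have e : arctan g = ∫ t in (0:ℝ)..g, (1 + t ^ 2)⁻¹ := by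
    rw [integral_inv_one_add_sq, arctan_zero, sub_zero]
  rw [owenT_eq, e, ← mul_sub, ← intervalIntegral.integral_sub
    ((continuous_owenKernel_right h).intervalIntegrable _ _) (hi.intervalIntegrable _ _), abs_mul,
    abs_of_pos (by positivity : 0 < 1 / (2 * π))]
  gcongr
  have := intervalIntegral.norm_integral_le_of_norm_le_const (a := 0) (b := g) (C := h ^ 2 / 2)
    (f := fun t => owenKernel h t - (1 + t ^ 2)⁻¹) fun t _ => ?_
  · simpa using this
  have hp : 0 < 1 + t ^ 2 := by positivity
  have h1 : exp (-h ^ 2 * (1 + t ^ 2) / 2) ≤ 1 := by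
    rw [exp_le_one_iff]
    have : 0 ≤ h ^ 2 * (1 + t ^ 2) := by positivity
    linarith
  have h2 := add_one_le_exp (-h ^ 2 * (1 + t ^ 2) / 2)
  have h3 : owenKernel h t - (1 + t ^ 2)⁻¹ = (exp (-h ^ 2 * (1 + t ^ 2) / 2) - 1) / (1 + t ^ 2) := by
    rw [owenKernel]
    ring
  rw [h3, norm_eq_abs, abs_div, abs_of_pos hp, div_le_iff₀ hp, abs_of_nonpos (by linarith)]
  linarith

lemma tendsto_owenT_of_tendsto_arctan {α : Type*} {l : Filter α} {u v : α → ℝ} {c d : ℝ}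
    (hu : Tendsto u l (𝓝 0)) (huv : Tendsto (fun i => u i * v i) l (𝓝 c))
    (hv : Tendsto (fun i => arctan (v i)) l (𝓝 d)) :
    Tendsto (fun i => owenT (u i) (v i)) l (𝓝 (1 / (2 * π) * d)) := by
  have hz : Tendsto (fun i => 1 / (2 * π) * (u i ^ 2 / 2 * |v i|)) l (𝓝 0) := by
    have := ((hu.abs.mul huv.abs).div_const 2).const_mul (1 / (2 * π))
    simp only [abs_zero, zero_mul, zero_div, mul_zero] at this
    refine this.congr fun i => ?_
    rw [abs_mul, ← mul_assoc, ← sq, sq_abs]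
    ring
  have h := squeeze_zero_norm
    (f := fun i => owenT (u i) (v i) - 1 / (2 * π) * arctan (v i)) (fun i => abs_owenT_sub_arctan_le (u i) (v i)) hz
  simpa using h.add (hv.const_mul (1 / (2 * π)))

lemma tendsto_owenT_slope_nhdsGT {a : ℝ} (ha : 0 < a) (b : ℝ) :
    Tendsto (fun x => owenT x ((a + b * x) / x)) (𝓝[>] 0) (𝓝 (1 / 4)) := by
  have hid : Tendsto (fun x : ℝ => x) (𝓝[>] 0) (𝓝 0) := tendsto_id.mono_left nhdsWithin_le_nhds
  have hne : ∀ᶠ x : ℝ in 𝓝[>] 0, x ≠ 0 := by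
    filter_upwards [self_mem_nhdsWithin] with x hx using ne_of_gt hx
  have h1 : Tendsto (fun x => x * ((a + b * x) / x)) (𝓝[>] 0) (𝓝 (a + b * 0)) := by
    refine Tendsto.congr' ?_ ((hid.const_mul b).const_add a)
    filter_upwards [hne] with x hx
    field_simp
  have h2 : Tendsto (fun x => (a + b * x) / x) (𝓝[>] 0) atTop := by
    refine Tendsto.congr' ?_
      (tendsto_atTop_add_const_right _ b (tendsto_inv_nhdsGT_zero.const_mul_atTop ha))
    filter_upwards [hne] with x hx
    field_simp
  have h3 := tendsto_owenT_of_tendsto_arctan hid h1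
    ((tendsto_arctan_atTop.mono_right nhdsWithin_le_nhds).comp h2)
  convert h3 using 2
  field_simp
  norm_num

lemma tendsto_owenT_slope_nhdsLT {a : ℝ} (ha : 0 < a) (b : ℝ) :
    Tendsto (fun x => owenT x ((a + b * x) / x)) (𝓝[<] 0) (𝓝 (-(1 / 4))) := by
  have hneg : Tendsto (fun x : ℝ => -x) (𝓝[<] 0) (𝓝[>] 0) := by
    simpa using tendsto_neg_nhdsLT (a := (0 : ℝ))
  refine ((tendsto_owenT_slope_nhdsGT ha (-b)).comp hneg).neg.congr fun x => ?_
  simp only [Function.comp, owenT_neg_left, ← owenT_neg_right]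
  congr 1
  rw [div_neg, neg_neg]
  ring

/-- The part of the closed form that depends continuously on `x ≠ 0`. -/
noncomputable def owenPrimitive (a b x : ℝ) : ℝ :=
  1 / 2 * stdNormalCdf x - owenT x ((a + b * x) / x)
    - owenT (a / √(1 + b ^ 2)) ((a * b + x * (1 + b ^ 2)) / a)

/-- The Gaussian integral on the left-hand side. -/
noncomputable def normalCdfIntegral (a b x : ℝ) : ℝ :=
  ∫ y in Iic x, stdNormalPdf y * stdNormalCdf (a + b * y)

lemma continuous_stdNormalPdf_mul_cdf (a b : ℝ) :
    Continuous fun y => stdNormalPdf y * stdNormalCdf (a + b * y) := by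
  have := continuous_stdNormalPdf
  have := continuous_stdNormalCdf
  fun_prop

lemma integrable_stdNormalPdf_mul_cdf (a b : ℝ) :
    Integrable fun y => stdNormalPdf y * stdNormalCdf (a + b * y) := by
  refine integrable_stdNormalPdf.mono
    (continuous_stdNormalPdf_mul_cdf a b).aestronglyMeasurable (Eventually.of_forall fun y => ?_)
  rw [norm_mul]
  refine mul_le_of_le_one_right (norm_nonneg _) ?_
  rw [norm_eq_abs, abs_of_nonneg (stdNormalCdf_nonneg _)]
  exact stdNormalCdf_le_one _

lemma hasDerivAt_normalCdfIntegral (a b x : ℝ) :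
    HasDerivAt (normalCdfIntegral a b) (stdNormalPdf x * stdNormalCdf (a + b * x)) x :=
  hasDerivAt_integral_Iic (continuous_stdNormalPdf_mul_cdf a b)
    (integrable_stdNormalPdf_mul_cdf a b) x

lemma hasDerivAt_owenPrimitive {a : ℝ} (ha : a ≠ 0) (b : ℝ) {x : ℝ} (hx : x ≠ 0) :
    HasDerivAt (owenPrimitive a b) (stdNormalPdf x * stdNormalCdf (a + b * x)) x := by
  have hg : HasDerivAt (fun x => (a + b * x) / x) (-a / x ^ 2) x := by
    refine ((((hasDerivAt_id x).const_mul b).const_add a).div (hasDerivAt_id x) hx).congr_deriv ?_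
    simp
  have hg2 : HasDerivAt (fun x => (a * b + x * (1 + b ^ 2)) / a) ((1 + b ^ 2) / a) x := by
    refine ((((hasDerivAt_id x).mul_const (1 + b ^ 2)).const_add (a * b)).div_const a).congr_deriv ?_
    simp
  have h2 := (hasDerivAt_owenT_right (a / √(1 + b ^ 2)) _).comp x hg2
  have h := (((hasDerivAt_stdNormalCdf x).const_mul (1 / 2)).sub (hasDerivAt_owenT_comp hg)).sub h2
  refine h.congr_deriv ?_
  have hb : 0 < 1 + b ^ 2 := by positivity
  have hq : 0 < x ^ 2 + (a + b * x) ^ 2 := by positivity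
  have k1 : owenKernel x ((a + b * x) / x) =
      exp (-(x ^ 2 + (a + b * x) ^ 2) / 2) * (x ^ 2 / (x ^ 2 + (a + b * x) ^ 2)) := by
    have e : 1 + ((a + b * x) / x) ^ 2 = (x ^ 2 + (a + b * x) ^ 2) / x ^ 2 := by field_simp
    rw [owenKernel, e, div_eq_mul_inv, inv_div]
    congr 2
    field_simp
  have k2 : owenKernel (a / √(1 + b ^ 2)) ((a * b + x * (1 + b ^ 2)) / a) =
      exp (-(x ^ 2 + (a + b * x) ^ 2) / 2) *
        (a ^ 2 / ((1 + b ^ 2) * (x ^ 2 + (a + b * x) ^ 2))) := by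
    have e : 1 + ((a * b + x * (1 + b ^ 2)) / a) ^ 2 =
        (1 + b ^ 2) * (x ^ 2 + (a + b * x) ^ 2) / a ^ 2 := by
      field_simp
      ring
    rw [owenKernel, e, div_eq_mul_inv, inv_div, div_pow, sq_sqrt hb.le]
    congr 2
    field_simp
  rw [k1, k2, mul_div_cancel₀ _ hx]
  have hq' := hq.ne'
  have k3 : 1 / (2 * π) * (exp (-(x ^ 2 + (a + b * x) ^ 2) / 2) *
        (a ^ 2 / ((1 + b ^ 2) * (x ^ 2 + (a + b * x) ^ 2)))) * ((1 + b ^ 2) / a) =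
      -(1 / (2 * π) * (exp (-(x ^ 2 + (a + b * x) ^ 2) / 2) *
        (x ^ 2 / (x ^ 2 + (a + b * x) ^ 2))) * (-a / x ^ 2)) := by
    generalize x ^ 2 + (a + b * x) ^ 2 = q at *
    field_simp
  rw [k3]
  ring

lemma sub_owenPrimitive_eq {a : ℝ} (ha : a ≠ 0) (b : ℝ) {s : Set ℝ} (hs : IsOpen s)
    (hc : IsPreconnected s) (h0 : ∀ x ∈ s, x ≠ 0) {x y : ℝ} (hx : x ∈ s) (hy : y ∈ s) :
    normalCdfIntegral a b x - owenPrimitive a b x =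
      normalCdfIntegral a b y - owenPrimitive a b y := by
  have hd : ∀ z ∈ s, HasDerivAt (fun z => normalCdfIntegral a b z - owenPrimitive a b z) 0 z := by
    intro z hz
    exact ((hasDerivAt_normalCdfIntegral a b z).sub
      (hasDerivAt_owenPrimitive ha b (h0 z hz))).congr_deriv (sub_self _)
  exact hs.is_const_of_deriv_eq_zero hc
    (fun z hz => (hd z hz).differentiableAt.differentiableWithinAt) (fun z hz => (hd z hz).deriv)
    hx hy

lemma tendsto_sub_owenPrimitive {a : ℝ} (ha : a ≠ 0) (b : ℝ) {l : Filter ℝ} (hl : l ≤ 𝓝 0) {c : ℝ}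
    (hc : Tendsto (fun x => owenT x ((a + b * x) / x)) l (𝓝 c)) :
    Tendsto (fun x => normalCdfIntegral a b x - owenPrimitive a b x) l
      (𝓝 (normalCdfIntegral a b 0 - 1 / 4 + c + owenT (a / √(1 + b ^ 2)) b)) := by
  have h1 := (hasDerivAt_normalCdfIntegral a b 0).continuousAt.tendsto.mono_left hl
  have h2 := (continuous_stdNormalCdf.tendsto 0).mono_left hl
  have h3 : Continuous fun x => owenT (a / √(1 + b ^ 2)) ((a * b + x * (1 + b ^ 2)) / a) :=
    (continuous_owenT_right _).comp (by fun_prop)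
  have h4 := (h3.tendsto 0).mono_left hl
  rw [stdNormalCdf_zero] at h2
  have h5 := h1.sub (((h2.const_mul (1 / 2)).sub hc).sub h4)
  rw [zero_mul, add_zero, mul_div_cancel_left₀ _ ha] at h5
  exact h5.trans_eq (congrArg 𝓝 (by ring))

lemma eq_of_tendsto_nhdsGT {a : ℝ} (ha : a ≠ 0) (b : ℝ) {x c : ℝ} (hx : 0 < x)
    (hc : Tendsto (fun x => owenT x ((a + b * x) / x)) (𝓝[>] 0) (𝓝 c)) :
    normalCdfIntegral a b x - owenPrimitive a b x =
      normalCdfIntegral a b 0 - 1 / 4 + c + owenT (a / √(1 + b ^ 2)) b := by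
  refine tendsto_nhds_unique (tendsto_const_nhds.congr' ?_)
    (tendsto_sub_owenPrimitive ha b nhdsWithin_le_nhds hc)
  filter_upwards [self_mem_nhdsWithin] with y hy
  exact sub_owenPrimitive_eq ha b isOpen_Ioi isPreconnected_Ioi (fun z hz => ne_of_gt hz) hx hy

lemma eq_of_tendsto_nhdsLT {a : ℝ} (ha : a ≠ 0) (b : ℝ) {x c : ℝ} (hx : x < 0)
    (hc : Tendsto (fun x => owenT x ((a + b * x) / x)) (𝓝[<] 0) (𝓝 c)) :
    normalCdfIntegral a b x - owenPrimitive a b x =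
      normalCdfIntegral a b 0 - 1 / 4 + c + owenT (a / √(1 + b ^ 2)) b := by
  refine tendsto_nhds_unique (tendsto_const_nhds.congr' ?_)
    (tendsto_sub_owenPrimitive ha b nhdsWithin_le_nhds hc)
  filter_upwards [self_mem_nhdsWithin] with y hy
  exact sub_owenPrimitive_eq ha b isOpen_Iio isPreconnected_Iio (fun z hz => ne_of_lt hz) hx hy

lemma tendsto_owenT_atTop {h : ℝ} (hh : 0 < h) :
    Tendsto (owenT h) atTop (𝓝 (1 / 2 * (1 - stdNormalCdf h))) := by
  have hF : ∀ x, normalCdfIntegral h 0 x = stdNormalCdf x * stdNormalCdf h := by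
    intro x
    simp only [normalCdfIntegral, zero_mul, add_zero]
    rw [integral_mul_const]
    rfl
  have key : ∀ x, 0 < x → owenT h (x / h) =
      1 / 2 * stdNormalCdf h - stdNormalCdf x * stdNormalCdf h + 1 / 2 * stdNormalCdf x
        - owenT x ((h + 0 * x) / x) := by
    intro x hx
    have := eq_of_tendsto_nhdsGT hh.ne' 0 hx (tendsto_owenT_slope_nhdsGT hh 0)
    rw [hF, hF, stdNormalCdf_zero, owenPrimitive] at this
    have z : owenT h 0 = 0 := by simp [owenT]
    norm_num [z] at this ⊢
    linarith
  have hT : Tendsto (fun x => owenT x ((h + 0 * x) / x)) atTop (𝓝 0) :=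
    tendsto_owenT_zero (tendsto_pow_atTop two_ne_zero)
  have hlim : Tendsto (fun x => owenT h (x / h)) atTop (𝓝 (1 / 2 * (1 - stdNormalCdf h))) := by
    have h1 := ((((tendsto_stdNormalCdf_atTop.mul_const (stdNormalCdf h)).const_sub
      (1 / 2 * stdNormalCdf h)).add (tendsto_stdNormalCdf_atTop.const_mul (1 / 2))).sub hT)
    have h2 := h1.congr' (f₂ := fun x => owenT h (x / h)) (by
      filter_upwards [eventually_gt_atTop 0] with x hx using (key x hx).symm)
    convert h2 using 2
    ring
  refine (hlim.comp (tendsto_id.atTop_mul_const hh)).congr fun x => ?_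
  simp [hh.ne']

lemma tendsto_owenT_atBot {h : ℝ} (hh : 0 < h) :
    Tendsto (owenT h) atBot (𝓝 (1 / 2 * (stdNormalCdf h - 1))) := by
  have := ((tendsto_owenT_atTop hh).comp tendsto_neg_atBot_atTop).neg
  convert this.congr (fun x => ?_) using 2
  · ring
  · simp [owenT_neg_right]

lemma eq_of_tendsto_atBot {a : ℝ} (ha : a ≠ 0) (b : ℝ) {x c : ℝ} (hx : x < 0)
    (hc : Tendsto (fun x => owenT (a / √(1 + b ^ 2)) ((a * b + x * (1 + b ^ 2)) / a))
      atBot (𝓝 c)) :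
    normalCdfIntegral a b x - owenPrimitive a b x = c := by
  have h1 : Tendsto (normalCdfIntegral a b) atBot (𝓝 0) := tendsto_integral_Iic_zero tendsto_id
  have h2 : Tendsto (fun x => owenT x ((a + b * x) / x)) atBot (𝓝 0) :=
    tendsto_owenT_zero ((tendsto_pow_atTop two_ne_zero).comp tendsto_neg_atBot_atTop |>.congr
      fun x => by simp)
  have h3 := h1.sub (((tendsto_stdNormalCdf_atBot.const_mul (1 / 2)).sub h2).sub hc)
  refine tendsto_nhds_unique (tendsto_const_nhds.congr' ?_) (h3.trans_eq (by simp))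
  filter_upwards [eventually_lt_atBot 0] with y hy
  exact sub_owenPrimitive_eq ha b isOpen_Iio isPreconnected_Iio (fun z hz => ne_of_lt hz) hx hy

lemma tendsto_affine_atBot (c : ℝ) {d : ℝ} (hd : 0 < d) :
    Tendsto (fun x : ℝ => c + x * d) atBot atBot :=
  tendsto_atBot_add_const_left _ c (tendsto_id.atBot_mul_const hd)

lemma normalCdfIntegral_eq_of_pos {a : ℝ} (ha : 0 < a) (b : ℝ) {x : ℝ} (hx : x ≠ 0) :
    normalCdfIntegral a b x - owenPrimitive a b x =
      1 / 2 * stdNormalCdf (a / √(1 + b ^ 2)) - 1 / 2 * (if x < 0 then 1 else 0) := by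
  have hneg : ∀ y < 0, normalCdfIntegral a b y - owenPrimitive a b y =
      1 / 2 * (stdNormalCdf (a / √(1 + b ^ 2)) - 1) := fun y hy =>
    eq_of_tendsto_atBot ha.ne' b hy ((tendsto_owenT_atBot (by positivity)).comp
      ((tendsto_affine_atBot _ (by positivity)).atBot_div_const ha))
  rcases lt_or_gt_of_ne hx with h | h
  · rw [hneg x h, if_pos h]
    ring
  · have h1 := hneg (-1) (by norm_num)
    rw [eq_of_tendsto_nhdsLT ha.ne' b (by norm_num) (tendsto_owenT_slope_nhdsLT ha b)] at h1
    rw [eq_of_tendsto_nhdsGT ha.ne' b h (tendsto_owenT_slope_nhdsGT ha b), if_neg h.not_gt]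
    linarith

lemma normalCdfIntegral_eq_of_neg {a : ℝ} (ha : a < 0) (b : ℝ) {x : ℝ} (hx : x ≠ 0) :
    normalCdfIntegral a b x - owenPrimitive a b x =
      1 / 2 * stdNormalCdf (a / √(1 + b ^ 2)) - 1 / 2 * (if 0 < x then 1 else 0) := by
  have ha' : 0 < -a := by linarith
  have slope : (fun x => -owenT x ((-a + -b * x) / x)) = fun x => owenT x ((a + b * x) / x) := by
    ext x
    rw [← owenT_neg_right]
    congr 1
    ring
  have hneg : ∀ y < 0, normalCdfIntegral a b y - owenPrimitive a b y =
      1 / 2 * stdNormalCdf (a / √(1 + b ^ 2)) := by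
    refine fun y hy => eq_of_tendsto_atBot ha.ne b hy ?_
    have hp : 0 < -a / √(1 + b ^ 2) := by positivity
    have h1 := (tendsto_owenT_atBot hp).comp
      ((tendsto_affine_atBot (a * b) (by positivity : 0 < 1 + b ^ 2)).atBot_div_const ha')
    rw [neg_div, stdNormalCdf_neg] at h1
    convert h1.neg.congr (fun x => ?_) using 2
    · ring
    · simp only [Function.comp, owenT_neg_left, ← owenT_neg_right, div_neg, neg_neg]
  rcases lt_or_gt_of_ne hx with h | h
  · rw [hneg x h, if_neg h.not_gt]
    ring
  · have h1 := hneg (-1) (by norm_num)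
    rw [eq_of_tendsto_nhdsLT ha.ne b (by norm_num)
      (slope ▸ (tendsto_owenT_slope_nhdsLT ha' (-b)).neg)] at h1
    rw [eq_of_tendsto_nhdsGT ha.ne b h (slope ▸ (tendsto_owenT_slope_nhdsGT ha' (-b)).neg),
      if_pos h]
    linarith

theorem stmt9 (a b : ℝ) (ha : a ≠ 0) (x : ℝ) (hx : x ≠ 0) :
    (∫ y in Set.Iic x, stdNormalPdf y * stdNormalCdf (a + b * y)) =
      (1 / 2) * stdNormalCdf x + (1 / 2) * stdNormalCdf (a / Real.sqrt (1 + b ^ 2))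
        - (1 / 2) * (if a / (x * Real.sqrt (1 + b ^ 2)) < 0 then 1 else 0)
        - owenT x ((a + b * x) / x)
        - owenT (a / Real.sqrt (1 + b ^ 2)) ((a * b + x * (1 + b ^ 2)) / a) := by
  have hs : 0 < √(1 + b ^ 2) := by positivity
  change normalCdfIntegral a b x = _
  rcases lt_or_gt_of_ne ha with h | h
  · have key := normalCdfIntegral_eq_of_neg h b hx
    have hi : a / (x * √(1 + b ^ 2)) < 0 ↔ 0 < x := by
      rw [div_neg_iff]
      simp [h, h.not_gt, hs]
    simp only [hi]
    rw [owenPrimitive] at key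
    linarith
  · have key := normalCdfIntegral_eq_of_pos h b hx
    have hi : a / (x * √(1 + b ^ 2)) < 0 ↔ x < 0 := by
      rw [div_neg_iff]
      simp [h, h.not_gt, mul_neg_iff, hs, hs.not_gt]
    simp only [hi]
    rw [owenPrimitive] at key
    linarith
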